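/- arXiv:2512.19335 — 5 statements merged into one kernel-verified Lean document; each statement's English description precedes it below -/
import Mathlib

section
/- Let (b_n)_{n≥0} be a sequence of integers with b_0 = 1 and b_n even for every n ≥ 1, and let (a_n)_{n≥0} be a sequence of rational numbers with a_0 = 1 such that for every n ≥ 0 one has ∑_{k=0}^{n} a_k · a_{n−k} = b_n. Then for every n ≥ 0 the rational number 2^(n − s₂(n)) · a_n is an integer, where s₂(n) denotes the sum of the binary digits of n. -/
/-- The `2`-adic valuation of `n!` splits along a binomial coefficient. -/
lemma padicValNat_two_factorial_eq_add {n k : ℕ} (hk : k ≤ n) :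
    padicValNat 2 n.factorial = padicValNat 2 (n.choose k) +
      (padicValNat 2 k.factorial + padicValNat 2 (n - k).factorial) := by
  rw [← Nat.choose_mul_factorial_mul_factorial hk, mul_assoc,
    padicValNat.mul (Nat.choose_pos hk).ne' (by positivity),
    padicValNat.mul (by positivity) (by positivity)]

/-- A symmetric sum is even as soon as its middle term, if there is one, is even. -/
lemma even_sum_Ico_of_symm {n : ℕ} {c : ℕ → ℤ}
    (hsymm : ∀ k ∈ Finset.Ico 1 n, c (n - k) = c k)
    (hmid : ∀ k ∈ Finset.Ico 1 n, n - k = k → Even (c k)) :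
    Even (∑ k ∈ Finset.Ico 1 n, c k) := by
  rw [← ZMod.intCast_eq_zero_iff_even, Int.cast_sum]
  refine Finset.sum_involution (fun k _ => n - k) (fun k hk => ?_) (fun k hk hne heq => ?_)
    (fun k hk => ?_) (fun k hk => ?_)
  · rw [hsymm k hk]
    exact CharTwo.add_self_eq_zero _
  · exact hne ((ZMod.intCast_eq_zero_iff_even).2 (hmid k hk heq))
  · simp only [Finset.mem_Ico] at hk ⊢
    lia
  · simp only [Finset.mem_Ico] at hk
    lia

/-- Integrality of a formal square root, with the denominators bounded by the `2`-part of `n!`. -/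
lemma exists_int_two_pow_padicValNat_factorial_mul (b : ℕ → ℤ) (a : ℕ → ℚ)
    (hbeven : ∀ n : ℕ, 1 ≤ n → Even (b n)) (ha0 : a 0 = 1)
    (hab : ∀ n : ℕ, ∑ k ∈ Finset.range (n + 1), a k * a (n - k) = (b n : ℚ)) (n : ℕ) :
    ∃ z : ℤ, (2 : ℚ) ^ padicValNat 2 n.factorial * a n = (z : ℚ) := by
  induction n using Nat.strong_induction_on with
  | _ n ih =>
  rcases Nat.eq_zero_or_pos n with rfl | hn
  · exact ⟨1, by simp [ha0]⟩
  have ih' : ∀ k, ∃ z : ℤ, k < n → (2 : ℚ) ^ padicValNat 2 k.factorial * a k = (z : ℚ) := by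
    intro k
    by_cases hk : k < n
    · obtain ⟨z, hz⟩ := ih k hk
      exact ⟨z, fun _ => hz⟩
    · exact ⟨0, fun h => absurd h hk⟩
  choose z hz using ih'
  set c : ℕ → ℤ := fun k => 2 ^ padicValNat 2 (n.choose k) * (z k * z (n - k)) with hc
  have hterm : ∀ k ∈ Finset.Ico 1 n,
      (2 : ℚ) ^ padicValNat 2 n.factorial * (a k * a (n - k)) = (c k : ℚ) := by
    intro k hk
    rw [Finset.mem_Ico] at hk
    rw [padicValNat_two_factorial_eq_add hk.2.le, hc]
    push_cast
    rw [← hz k hk.2, ← hz (n - k) (by lia)]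
    ring
  obtain ⟨r, hr⟩ : Even (∑ k ∈ Finset.Ico 1 n, c k) := by
    refine even_sum_Ico_of_symm (fun k hk => ?_) (fun k hk hmid => ?_)
    · rw [Finset.mem_Ico] at hk
      simp only [hc]
      rw [Nat.choose_symm hk.2.le, Nat.sub_sub_self hk.2.le, mul_comm (z k)]
    · rw [Finset.mem_Ico] at hk
      have hdvd : 2 ∣ n.choose k := by
        have h := Nat.two_dvd_centralBinom_of_one_le hk.1
        rwa [Nat.centralBinom_eq_two_mul_choose, show 2 * k = n by lia] at h
      have hval := one_le_padicValNat_of_dvd (Nat.choose_pos hk.2.le).ne' hdvd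
      exact (even_two.pow_of_ne_zero (by lia)).mul_right _
  obtain ⟨t, ht⟩ := hbeven n hn
  have hsum : 2 * a n + ∑ k ∈ Finset.Ico 1 n, a k * a (n - k) = (b n : ℚ) := by
    rw [← hab n, Finset.sum_range_succ, Finset.range_eq_Ico, Finset.sum_eq_sum_Ico_succ_bot hn]
    simp only [Nat.sub_zero, Nat.sub_self, ha0]
    ring
  have hscaled : (2 : ℚ) ^ padicValNat 2 n.factorial * ∑ k ∈ Finset.Ico 1 n, a k * a (n - k)
      = r + r := by
    rw [Finset.mul_sum, Finset.sum_congr rfl hterm]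
    exact_mod_cast hr
  refine ⟨2 ^ padicValNat 2 n.factorial * t - r, ?_⟩
  rw [ht] at hsum
  push_cast at hsum ⊢
  linear_combination (2 : ℚ) ^ padicValNat 2 n.factorial / 2 * hsum - hscaled / 2

/-- The inductive core of Lemma 2.2: if `(aₙ)` are rationals with `a₀ = 1` whose
"square" `∑_{k=0}^{n} aₖ aₙ₋ₖ = bₙ` is an integer sequence with `b₀ = 1` and `bₙ` even for
`n ≥ 1`, then `2^(n - s₂(n)) · aₙ` is an integer, where `s₂(n)` is the binary digit sum. -/
theorem almost_flat_stmt0 (b : ℕ → ℤ) (a : ℕ → ℚ)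
    (hb0 : b 0 = 1) (hbeven : ∀ n : ℕ, 1 ≤ n → Even (b n))
    (ha0 : a 0 = 1)
    (hab : ∀ n : ℕ, ∑ k ∈ Finset.range (n + 1), a k * a (n - k) = (b n : ℚ)) :
    ∀ n : ℕ, ∃ z : ℤ,
      (2 : ℚ) ^ (n - (Nat.digits 2 n).sum) * a n = (z : ℚ) := by
  intro n
  have hlegendre := sub_one_mul_padicValNat_factorial (p := 2) n
  rw [Nat.add_one_sub_one, one_mul] at hlegendre
  rw [← hlegendre]
  exact exists_int_two_pow_padicValNat_factorial_mul b a hbeven ha0 hab n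
end

section
/- Let h ∈ ℚ[[X]] be the formal power series with coefficient 1 in degree 0 and, for m ≥ 1, coefficient 1 in degree m if m is a power of 2 and coefficient 0 otherwise (so h = 1 + X + X² + X⁴ + X⁸ + ⋯). Suppose f ∈ ℚ[[X]] has constant coefficient 1 and satisfies f(X)² · h(X) = h(−X) (where h(−X) is the rescaling of h by −1). Then for every n ≥ 0, the rational number 2^(n − s₂(n)) · (coefficient of Xⁿ in f) is an integer, where s₂(n) denotes the sum of the binary digits of n. -/
open PowerSeries

/-- A symmetric function that is even on the diagonal has even sum over an antidiagonal. -/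
lemma even_sum_antidiagonal_of_symm (t : ℕ → ℕ → ℤ) (m : ℕ)
    (symm : ∀ i j, t i j = t j i) (diag : ∀ i, i + i = m → Even (t i i)) :
    Even (∑ p ∈ Finset.HasAntidiagonal.antidiagonal m, t p.1 p.2) := by
  rw [← ZMod.intCast_eq_zero_iff_even]
  push_cast
  refine Finset.sum_involution (fun p _ => p.swap) ?_ ?_ ?_ ?_
  · intro p _
    rw [Prod.fst_swap, Prod.snd_swap, symm p.2 p.1]
    exact CharTwo.add_self_eq_zero _
  · rintro ⟨i, j⟩ hp hne heq
    obtain rfl : j = i := congrArg Prod.fst heq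
    exact hne (ZMod.intCast_eq_zero_iff_even.2
      (diag j (Finset.HasAntidiagonal.mem_antidiagonal.1 hp)))
  · intro p hp
    exact Finset.HasAntidiagonal.swap_mem_antidiagonal.2 hp
  · intro p _
    exact p.swap_swap

lemma padicValNat_factorial_add_le (i j : ℕ) :
    padicValNat 2 i.factorial + padicValNat 2 j.factorial ≤ padicValNat 2 (i + j).factorial := by
  rw [← padicValNat.mul i.factorial_ne_zero j.factorial_ne_zero]
  exact padicValNat_dvd_iff_le (i + j).factorial_ne_zero |>.1
    (pow_padicValNat_dvd.trans (Nat.factorial_mul_factorial_dvd_factorial_add i j))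

lemma padicValNat_factorial_add_self_lt {i : ℕ} (hi : i ≠ 0) :
    padicValNat 2 i.factorial + padicValNat 2 i.factorial
      < padicValNat 2 (i + i).factorial := by
  have hlt := sub_one_mul_padicValNat_factorial_lt_of_ne_zero 2 hi
  have hmul := padicValNat_factorial_mul (p := 2) i
  rw [← two_mul i]
  omega

/-- If the square of a rational power series `f` with constant coefficient `1` has integral
coefficients and the linear coefficient of `f` is integral, then `n!` bounds the power of `2`
in the denominator of the `n`-th coefficient of `f`. -/
lemma exists_int_eq_two_pow_mul_coeff_of_sq {f : PowerSeries ℚ} {u : PowerSeries ℤ}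
    (hf0 : coeff 0 f = 1) (hf1 : ∃ z : ℤ, coeff 1 f = z)
    (hsq : f ^ 2 = PowerSeries.map (Int.castRingHom ℚ) u) (n : ℕ) :
    ∃ z : ℤ, (2 : ℚ) ^ padicValNat 2 n.factorial * coeff n f = z := by
  induction n using Nat.strong_induction_on with
  | _ n ih =>
  match n, ih with
  | 0, _ => exact ⟨1, by simp [hf0]⟩
  | 1, _ => simpa using hf1
  | m + 2, ih =>
    set v : ℕ → ℕ := fun k => padicValNat 2 k.factorial with hv
    have hex : ∀ k, ∃ z : ℤ, k < m + 2 → (2 : ℚ) ^ v k * coeff k f = z := fun k => by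
      by_cases hk : k < m + 2
      · obtain ⟨z, hz⟩ := ih k hk
        exact ⟨z, fun _ => hz⟩
      · exact ⟨0, fun h => absurd h hk⟩
    choose z hz using hex
    have hsum := congrArg (coeff (m + 2)) hsq
    rw [sq, coeff_mul, Finset.Nat.antidiagonal_succ_succ'] at hsum
    simp only [Finset.sum_cons, Finset.sum_map, hf0, coeff_map, one_mul, mul_one,
      Function.Embedding.prodMap, Function.Embedding.coeFn_mk, Prod.map,
      Nat.succ_eq_add_one, eq_intCast] at hsum
    let t : ℕ → ℕ → ℤ := fun i j =>
      2 ^ (v (m + 2) - (v (i + 1) + v (j + 1))) * (z (i + 1) * z (j + 1))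
    have heven : Even (∑ p ∈ Finset.HasAntidiagonal.antidiagonal m, t p.1 p.2) := by
      refine even_sum_antidiagonal_of_symm t m (fun i j => ?_) (fun i hi => ?_)
      · simp only [t, add_comm (v (i + 1)), mul_comm (z (i + 1))]
      · have hlt := padicValNat_factorial_add_self_lt (Nat.succ_ne_zero i)
        rw [show i.succ + i.succ = m + 2 by omega] at hlt
        exact (even_two.pow_of_ne_zero (Nat.sub_ne_zero_of_lt hlt)).mul_right _
    obtain ⟨e, he⟩ := heven
    have ht : (∑ p ∈ Finset.HasAntidiagonal.antidiagonal m, (2 : ℚ) ^ v (m + 2) *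
        (coeff (p.1 + 1) f * coeff (p.2 + 1) f)) = e + e := by
      rw [← Int.cast_add, ← he, Int.cast_sum]
      refine Finset.sum_congr rfl fun p hp => ?_
      have hp := Finset.HasAntidiagonal.mem_antidiagonal.1 hp
      have hle := padicValNat_factorial_add_le (p.1 + 1) (p.2 + 1)
      rw [show p.1 + 1 + (p.2 + 1) = m + 2 by omega] at hle
      simp only [t, Int.cast_mul, Int.cast_pow, Int.cast_ofNat]
      rw [← hz (p.1 + 1) (by omega), ← hz (p.2 + 1) (by omega)]
      have hpow : (2 : ℚ) ^ v (m + 2) =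
          2 ^ (v (m + 2) - (v (p.1 + 1) + v (p.2 + 1))) *
            (2 ^ v (p.1 + 1) * 2 ^ v (p.2 + 1)) := by
        rw [← pow_add, ← pow_add, Nat.sub_add_cancel hle]
      rw [hpow]
      ring
    have hpos : v (m + 2) ≠ 0 := by
      have hlt := padicValNat_factorial_add_le 2 m
      have h2 : padicValNat 2 (Nat.factorial 2) = 1 := by simp
      rw [add_comm 2 m] at hlt
      simp only [hv]
      omega
    obtain ⟨w, hw⟩ := Nat.exists_eq_succ_of_ne_zero hpos
    refine ⟨2 ^ w * coeff (m + 2) u - e, ?_⟩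
    rw [← Finset.mul_sum] at ht
    change (2 : ℚ) ^ v (m + 2) * _ = _
    push_cast
    rw [hw, pow_succ] at ht ⊢
    linear_combination (2 : ℚ) ^ w * hsum - ht / 2


/-- Lemma 2.2 of the paper: let `h = 1 + X + X² + X⁴ + X⁸ + ⋯ ∈ ℚ[[X]]` (coefficient `1`
in degree `0` and in each degree that is a power of `2`, and `0` otherwise).  If
`f ∈ ℚ[[X]]` has constant coefficient `1` and `f² · h(X) = h(-X)`, then for every `n` the
rational `2^(n - s₂(n)) · (coeff of Xⁿ in f)` is an integer, where `s₂(n)` is the binary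
digit sum of `n`. -/
theorem almost_flat_stmt1 (h f : PowerSeries ℚ)
    (hh0 : PowerSeries.coeff 0 h = 1)
    (hhpow : ∀ k : ℕ, PowerSeries.coeff (2 ^ k) h = 1)
    (hhzero : ∀ m : ℕ, m ≠ 0 → (∀ k : ℕ, m ≠ 2 ^ k) → PowerSeries.coeff m h = 0)
    (hf0 : PowerSeries.constantCoeff f = 1)
    (hfsq : f ^ 2 * h = PowerSeries.rescale (-1) h) :
    ∀ n : ℕ, ∃ z : ℤ,
      (2 : ℚ) ^ (n - (Nat.digits 2 n).sum) * PowerSeries.coeff n f = (z : ℚ) := by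
  intro n
  have h_integral : ∀ m, ∃ z : ℤ, coeff m h = z := fun m => by
    by_cases hm : m = 0
    · exact ⟨1, by simpa [hm] using hh0⟩
    by_cases hk : ∃ k, m = 2 ^ k
    · obtain ⟨k, rfl⟩ := hk
      exact ⟨1, by simpa using hhpow k⟩
    · exact ⟨0, by simpa using hhzero m hm (not_exists.1 hk)⟩
  choose c hc using h_integral
  let H : PowerSeries ℤ := PowerSeries.mk c
  have hH : PowerSeries.map (Int.castRingHom ℚ) H = h := by
    ext m
    simp [H, hc]
  have hH0 : constantCoeff H = ((1 : ℤˣ) : ℤ) := by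
    have := hc 0
    rw [hh0] at this
    simpa [H] using (Int.cast_injective (α := ℚ) (by simpa using this)).symm
  have hinv := congrArg (PowerSeries.map (Int.castRingHom ℚ)) (mul_invOfUnit H 1 hH0)
  rw [map_mul, hH, map_one] at hinv
  have hresc : PowerSeries.map (Int.castRingHom ℚ) (rescale (-1) H) = rescale (-1) h := by
    ext m
    simp [H, coeff_rescale, hc]
  have hsq : f ^ 2 =
      PowerSeries.map (Int.castRingHom ℚ) (rescale (-1) H * invOfUnit H 1) := by
    rw [map_mul, hresc, ← hfsq, mul_assoc, hinv, mul_one]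
  have hf0' : coeff 0 f = 1 := by simpa using hf0
  have hf1 : coeff 1 f = ((-1 : ℤ) : ℚ) := by
    have h1 : coeff 1 h = 1 := by simpa using hhpow 0
    have hcoeff := congrArg (coeff 1) hfsq
    rw [sq, coeff_one_mul, coeff_one_mul, coeff_rescale, map_mul, hf0, h1,
      ← coeff_zero_eq_constantCoeff_apply, hh0] at hcoeff
    push_cast
    linarith
  have hval := sub_one_mul_padicValNat_factorial (p := 2) n
  rw [Nat.add_one_sub_one, one_mul] at hval
  rw [← hval]
  exact exists_int_eq_two_pow_mul_coeff_of_sq hf0' ⟨_, hf1⟩ hsq n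
end

section
/- Let h ∈ ℤ[[X]] be the formal power series with coefficient 1 in degree 0 and, for m ≥ 1, coefficient 1 in degree m if m is a power of 2 and coefficient 0 otherwise (so h = 1 + X + X² + X⁴ + X⁸ + ⋯). Then h is a unit in ℤ[[X]], and if q ∈ ℤ[[X]] is the series with q · h(X) = h(−X), then the constant coefficient of q equals 1 and for every n ≥ 1 the coefficient of Xⁿ in q is even. -/
open PowerSeries

/-- Over `ℤ`, the substitution `X ↦ -X` is trivial modulo `2`. -/
theorem map_zmod_two_rescale_neg_one (f : PowerSeries ℤ) :
    PowerSeries.map (Int.castRingHom (ZMod 2)) (PowerSeries.rescale (-1) f) =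
      PowerSeries.map (Int.castRingHom (ZMod 2)) f := by
  have h_neg_one : Int.castRingHom (ZMod 2) (-1) = 1 := by decide
  rw [← PowerSeries.rescale_map, h_neg_one, PowerSeries.rescale_one, RingHom.id_apply]

/-- Let `h = 1 + X + X² + X⁴ + X⁸ + ⋯ ∈ ℤ[[X]]` (coefficient `1` in degree `0` and in each
degree that is a power of `2`, and `0` otherwise).  Then `h` is a unit in `ℤ[[X]]`, and the
series `q` with `q · h(X) = h(-X)` has constant coefficient `1` and all its
positive-degree coefficients even; i.e. `h(-X)/h(X) ≡ 1 mod 2`. -/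
theorem almost_flat_stmt2 (h : PowerSeries ℤ)
    (hh0 : PowerSeries.coeff 0 h = 1)
    (hhpow : ∀ k : ℕ, PowerSeries.coeff (2 ^ k) h = 1)
    (hhzero : ∀ m : ℕ, m ≠ 0 → (∀ k : ℕ, m ≠ 2 ^ k) → PowerSeries.coeff m h = 0) :
    IsUnit h ∧
      ∀ q : PowerSeries ℤ, q * h = PowerSeries.rescale (-1) h →
        PowerSeries.constantCoeff q = 1 ∧ ∀ n : ℕ, 1 ≤ n → Even (PowerSeries.coeff n q) := by
  have hconst : PowerSeries.constantCoeff h = 1 := by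
    rwa [← PowerSeries.coeff_zero_eq_constantCoeff_apply]
  have hunit : IsUnit h := by
    rw [PowerSeries.isUnit_iff_constantCoeff, hconst]
    exact isUnit_one
  refine ⟨hunit, fun q hq => ⟨?_, fun n hn => ?_⟩⟩
  · have hcoeff := congrArg (PowerSeries.coeff 0) hq
    rw [PowerSeries.coeff_rescale, hh0] at hcoeff
    simpa [hconst] using hcoeff
  · have hmap : PowerSeries.map (Int.castRingHom (ZMod 2)) q = 1 := by
      apply (hunit.map (PowerSeries.map (Int.castRingHom (ZMod 2)))).mul_right_cancel
      rw [← map_mul, hq, map_zmod_two_rescale_neg_one, one_mul]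
    have hcoeff := congrArg (PowerSeries.coeff n) hmap
    rw [PowerSeries.coeff_map, PowerSeries.coeff_one, if_neg (by lia)] at hcoeff
    exact ZMod.intCast_eq_zero_iff_even.mp hcoeff
end

section
/- Let A be a finite group. Then the third group cohomology H³(A; ℤ) of A with coefficients in the trivial A-module ℤ is trivial if and only if the second group homology H₂(A; ℤ) of A with coefficients in the trivial A-module ℤ is trivial. -/
open CategoryTheory

universe u

/-- The submodule of a representation generated by the elements `ρ g v - v`; the quotient
by it is the module of coinvariants. -/
def Representation.coinvariantsKer {k G V : Type u} [CommRing k] [Group G] [AddCommGroup V]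
    [Module k V] (ρ : Representation k G V) : Submodule k V :=
  Submodule.span k (Set.range fun x : G × V => ρ x.1 x.2 - x.2)

variable (k G : Type u) [CommRing k] [Group G]

/-- The coinvariants `A_G` of a representation `A`, i.e. the largest quotient of `A` on
which `G` acts trivially. -/
noncomputable def Rep.coinvariants (A : Rep.{u} k G) : ModuleCat k :=
  ModuleCat.of k (A.V ⧸ A.ρ.coinvariantsKer)

/-- The map on coinvariants induced by a morphism of representations. -/
noncomputable def Rep.coinvariantsMap {A B : Rep.{u} k G} (f : A ⟶ B) :
    Rep.coinvariants k G A ⟶ Rep.coinvariants k G B :=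
  ModuleCat.ofHom <| Submodule.mapQ _ _ f.hom.toLinearMap (by
    rw [Representation.coinvariantsKer, Submodule.span_le]
    rintro x ⟨⟨g, v⟩, rfl⟩
    simp only [SetLike.mem_coe, Submodule.mem_comap, map_sub, Rep.hom_comm_apply]
    refine Submodule.subset_span ⟨(g, f.hom v), ?_⟩
    have h := (Rep.hom_comm_apply f g v).symm
    simp only [h]
    rfl)

/-- The coinvariants functor `Rep k G ⥤ ModuleCat k`. -/
noncomputable def Rep.coinvariantsFunctor' : Rep.{u} k G ⥤ ModuleCat k where
  obj A := Rep.coinvariants k G A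
  map f := Rep.coinvariantsMap k G f
  map_id A := ModuleCat.hom_ext <| Submodule.linearMap_qext _ (by ext x; rfl)
  map_comp f g := ModuleCat.hom_ext <| Submodule.linearMap_qext _ (by ext x; rfl)

instance : (Rep.coinvariantsFunctor' k G).Additive where
  map_add := ModuleCat.hom_ext <| Submodule.linearMap_qext _ (by ext x; rfl)

/-- Group homology `H_n(G; A)` of a representation `A` of `G` over `k`: the homology of
the complex of coinvariants of `P ⊗ A`, where `P` is the standard resolution of the
trivial representation `k`. -/
noncomputable def groupHomology' {k G : Type u} [CommRing k] [Group G] (A : Rep.{u} k G)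
    (n : ℕ) : ModuleCat k :=
  ((((Rep.coinvariantsFunctor' k G).mapHomologicalComplex _).obj
      (((MonoidalCategory.tensorRight A).mapHomologicalComplex _).obj
        (Rep.standardComplex k G))).homology n)

section DualExactness

variable {L M N P : Type*} [AddCommGroup L] [AddCommGroup M] [AddCommGroup N] [AddCommGroup P]

/-- Let `L → M → N → P` be a complex of abelian groups with `N` and `P` finite free, on which
multiplication by nonzero integers is null-homotopic. It is exact at `N` if and only if its
`ℤ`-dual is exact at the dual of `M`. -/
theorem exact_iff_dual_exact_of_homotopy [Module.Finite ℤ N] [Module.Free ℤ N]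
    [Module.Finite ℤ P] [Module.Free ℤ P]
    {e : L →ₗ[ℤ] M} {f : M →ₗ[ℤ] N} {g : N →ₗ[ℤ] P}
    (hef : f ∘ₗ e = 0) (hfg : g ∘ₗ f = 0) {m n : ℤ} (hm : m ≠ 0) (hn : n ≠ 0)
    {s₁ : P →ₗ[ℤ] N} {s₂ : N →ₗ[ℤ] M} {s₃ : M →ₗ[ℤ] L}
    (hs₂ : f ∘ₗ s₂ = s₁ ∘ₗ g + m • LinearMap.id)
    (hs₃ : e ∘ₗ s₃ = s₂ ∘ₗ f + n • LinearMap.id) :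
    (∀ y, g y = 0 → ∃ x, f x = y) ↔
      ∀ φ : M →ₗ[ℤ] ℤ, φ ∘ₗ e = 0 → ∃ ψ : N →ₗ[ℤ] ℤ, ψ ∘ₗ f = φ := by
  constructor
  · intro h φ hφ
    have hker : LinearMap.ker f ≤ LinearMap.ker φ := by
      intro x hx
      have h1 := congr(φ ($hs₃ x))
      have h2 := congr($hφ (s₃ x))
      simp only [LinearMap.mem_ker] at hx
      simp only [LinearMap.comp_apply, LinearMap.add_apply, LinearMap.smul_apply,
        LinearMap.id_apply, hx, map_zero, zero_add, map_smul, LinearMap.zero_apply] at h1 h2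
      rw [h2] at h1
      exact (smul_eq_zero.1 h1.symm).resolve_left hn
    obtain ⟨t, ht⟩ := Module.projective_lifting_property g.rangeRestrict LinearMap.id
      g.surjective_rangeRestrict
    obtain ⟨u, hu⟩ := Module.projective_lifting_property f.rangeRestrict LinearMap.id
      f.surjective_rangeRestrict
    have hr : ∀ y, (LinearMap.id - t ∘ₗ g.rangeRestrict : N →ₗ[ℤ] N) y ∈ LinearMap.range f := by
      intro y
      apply h
      have := congr(($ht (g.rangeRestrict y)).1)
      simp only [LinearMap.comp_apply, LinearMap.id_apply, LinearMap.codRestrict_apply] at this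
      simp [this]
    refine ⟨φ ∘ₗ u ∘ₗ (LinearMap.id - t ∘ₗ g.rangeRestrict : N →ₗ[ℤ] N).codRestrict _ hr, ?_⟩
    ext x
    have hx : (LinearMap.id - t ∘ₗ g.rangeRestrict : N →ₗ[ℤ] N).codRestrict _ hr (f x) =
        f.rangeRestrict x := by
      have : g.rangeRestrict (f x) = 0 := Subtype.ext congr($hfg x)
      ext
      simp [this]
    have hux : u (f.rangeRestrict x) - x ∈ LinearMap.ker φ := by
      apply hker
      have := congr(($hu (f.rangeRestrict x)).1)
      simp only [LinearMap.comp_apply, LinearMap.id_apply, LinearMap.codRestrict_apply] at this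
      simp [this]
    rw [LinearMap.mem_ker, map_sub, sub_eq_zero] at hux
    simp only [LinearMap.comp_apply, hx, hux]
  · intro h y hy
    let b := Module.Free.chooseBasis ℤ (LinearMap.range f)
    have hψ : ∀ i, ∃ ψ : N →ₗ[ℤ] ℤ, ψ ∘ₗ f = b.coord i ∘ₗ f.rangeRestrict := fun i => by
      apply h
      ext x
      have : f.rangeRestrict (e x) = 0 := Subtype.ext congr($hef x)
      simp [this]
    choose ψ hψ using hψ
    have hx : f (s₂ y) = m • y := by simpa [hy] using congr($hs₂ y)
    have hr : ∀ x, ∑ i, ψ i (f x) • b i = f.rangeRestrict x := fun x => by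
      rw [← b.sum_repr (f.rangeRestrict x)]
      exact Finset.sum_congr rfl fun i _ => congr($(hψ i) x • b i)
    have h1 := congr(($(hr (s₂ y))).1)
    rw [hx] at h1
    simp only [map_smul, smul_assoc, ← Finset.smul_sum] at h1
    rw [Submodule.coe_smul, LinearMap.codRestrict_apply, hx] at h1
    obtain ⟨x, hx⟩ := (∑ i, ψ i y • b i : LinearMap.range f).2
    exact ⟨x, hx.trans (smul_right_injective N hm h1)⟩

end DualExactness

namespace Fin

variable {α : Type*} {n : ℕ}

theorem contractNth_castSucc_castSucc_snoc (op : α → α → α) (j : Fin n) (g : Fin (n + 1) → α)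
    (x : α) :
    contractNth j.castSucc.castSucc op (snoc g x : Fin (n + 2) → α) =
      snoc (contractNth j.castSucc op g) x := by
  ext k
  refine Fin.lastCases ?_ (fun k => ?_) k
  · rw [contractNth_apply_of_gt _ _ _ _ (by simp)]
    simp [succ_last]
  · simp only [snoc_castSucc, contractNth, succ_castSucc, val_castSucc]

theorem contractNth_castSucc_last_snoc (op : α → α → α) (g : Fin (n + 1) → α) (x : α) :
    contractNth (last n).castSucc op (snoc g x : Fin (n + 2) → α) =
      snoc (init g) (op (g (last n)) x) := by
  ext k
  refine Fin.lastCases ?_ (fun k => ?_) k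
  · rw [contractNth_apply_of_eq _ _ _ _ (by simp)]
    simp [succ_last]
  · rw [contractNth_apply_of_lt _ _ _ _ (by simp)]
    simp [init]

theorem contractNth_last (op : α → α → α) (g : Fin (n + 1) → α) :
    contractNth (last n) op g = init g := by
  ext k
  rw [contractNth_apply_of_lt _ _ _ _ (by simp)]
  rfl

theorem tail_snoc_eq_snoc_tail (g : Fin (n + 1) → α) (x : α) :
    tail (snoc g x : Fin (n + 2) → α) = snoc (tail g) x := by
  ext k
  refine Fin.lastCases ?_ (fun k => ?_) k
  · simp [tail, succ_last]
  · simp only [tail, snoc_castSucc, succ_castSucc]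

end Fin

namespace groupHomology.inhomogeneousChains

open Finsupp

/-- The linear map sending a tuple `(g₁, …, gₙ)` to the sum of all `(g₁, …, gₙ, x)` with
`x : G`. -/
noncomputable def snocSum (G : Type*) [Fintype G] (n : ℕ) :
    ((Fin n → G) →₀ ℤ) →ₗ[ℤ] ((Fin (n + 1) → G) →₀ ℤ) :=
  lsum ℤ fun g => ∑ x : G, lsingle (Fin.snoc g x : Fin (n + 1) → G)

@[simp]
theorem snocSum_single {G : Type*} [Fintype G] {n : ℕ} (g : Fin n → G) (a : ℤ) :
    snocSum G n (single g a) = ∑ x : G, single (Fin.snoc g x : Fin (n + 1) → G) a := by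
  simp [snocSum]

variable {G : Type} [Group G]

/-- The bar differential with trivial integral coefficients. -/
noncomputable def trivialD (G : Type) [Group G] (n : ℕ) :
    ((Fin (n + 1) → G) →₀ ℤ) →ₗ[ℤ] ((Fin n → G) →₀ ℤ) :=
  (d (Rep.trivial ℤ G ℤ) n).hom

theorem trivialD_single {n : ℕ} (g : Fin (n + 1) → G) (a : ℤ) :
    trivialD G n (single g a) = single (Fin.tail g) a +
      ∑ j : Fin (n + 1), (-1 : ℤ) ^ ((j : ℕ) + 1) • single (Fin.contractNth j (· * ·) g) a :=
  d_single (A := Rep.trivial ℤ G ℤ) n g a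

theorem trivialD_comp_trivialD (n : ℕ) : trivialD G n ∘ₗ trivialD G (n + 1) = 0 :=
  congr(($(d_comp_d (Rep.trivial ℤ G ℤ) n)).hom)

/-- Up to sign, `snocSum` is a chain homotopy between multiplication by `|G|` and zero in positive
degrees. -/
theorem trivialD_comp_snocSum [Fintype G] (n : ℕ) :
    trivialD G (n + 1) ∘ₗ snocSum G (n + 1) =
      snocSum G n ∘ₗ trivialD G n + ((-1) ^ n * (Fintype.card G : ℤ)) • LinearMap.id := by
  refine lhom_ext fun g a => ?_
  have hlast : ∑ x : G, single (Fin.snoc (Fin.init g) (g (Fin.last n) * x) : Fin (n + 1) → G) a =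
      ∑ x : G, single (Fin.snoc (Fin.init g) x : Fin (n + 1) → G) a :=
    Equiv.sum_comp (Equiv.mulLeft (g (Fin.last n)))
      fun x => single (Fin.snoc (Fin.init g) x : Fin (n + 1) → G) a
  simp only [LinearMap.comp_apply, LinearMap.add_apply, LinearMap.smul_apply, LinearMap.id_apply,
    snocSum_single, map_sum, trivialD_single, map_add, map_smul, Finset.sum_add_distrib,
    Fin.sum_univ_castSucc, Fin.contractNth_castSucc_castSucc_snoc,
    Fin.contractNth_castSucc_last_snoc, Fin.contractNth_last, Fin.init_snoc,
    Finset.sum_const, Finset.card_univ, ← Finset.smul_sum, hlast]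
  rw [Finset.sum_comm]
  simp only [Finset.smul_sum, Fin.tail_snoc_eq_snoc_tail, add_assoc, Fin.val_castSucc, Fin.val_last]
  congr 3
  rw [← natCast_zsmul, smul_smul, mul_comm]
  ring_nf

/-- The cochain differential is dual to the chain differential. -/
theorem llift_comp_trivialD {n : ℕ} (f : (Fin n → G) → ℤ) :
    llift ℤ ℤ ℤ _ f ∘ₗ trivialD G n =
      llift ℤ ℤ ℤ _ (inhomogeneousCochains.d (Rep.trivial ℤ G ℤ) n f) := by
  refine lhom_ext fun g a => ?_
  have llift_single (h : (Fin (n + 1) → G) → ℤ) : llift ℤ ℤ ℤ _ h (single g a) = a • h g := by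
    simp
  refine Eq.trans ?_ (llift_single _).symm
  change _ = a • (f (Fin.tail g) +
    ∑ j : Fin (n + 1), (-1 : ℤ) ^ ((j : ℕ) + 1) • f (Fin.contractNth j (· * ·) g))
  simp only [LinearMap.comp_apply, trivialD_single, map_add, map_sum, map_smul, llift_apply,
    lift_apply, sum_single_index, zero_smul, smul_add, Finset.smul_sum, smul_comm a]

end groupHomology.inhomogeneousChains

section Comparison

open MonoidalCategory

variable {k G}

/-- The functor `P ↦ (P ⊗ A)_G` is naturally isomorphic to `P ↦ (A ⊗ P)_G`. -/
noncomputable def Rep.tensorRightCoinvariantsIso (A : Rep.{u} k G) :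
    tensorRight A ⋙ Rep.coinvariantsFunctor' k G ≅ (Rep.coinvariantsTensor k G).obj A :=
  Functor.isoWhiskerRight (BraidedCategory.tensorLeftIsoTensorRight A).symm _ ≪≫
    Functor.isoWhiskerLeft (tensorLeft A)
      (NatIso.ofComponents (fun B => (Submodule.quotEquivOfEq _ _ rfl).toModuleIso)
        (fun f => ModuleCat.hom_ext <| Submodule.linearMap_qext _ (by ext x; rfl)) :
          Rep.coinvariantsFunctor' k G ≅ Rep.coinvariantsFunctor k G)

/-- Group homology computed from the standard resolution agrees with `groupHomology`. -/
noncomputable def groupHomologyStandardIso [DecidableEq G] (A : Rep.{u} k G) (n : ℕ) :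
    groupHomology' A n ≅ groupHomology A n :=
  (HomologicalComplex.homologyFunctor _ _ n).mapIso
      ((NatIso.mapHomologicalComplex (Rep.tensorRightCoinvariantsIso A) _).app
        (Rep.standardComplex k G)) ≪≫
    (groupHomologyIso A n (Rep.standardResolution k G)).symm

end Comparison

/-- Vanishing of integral homology in positive degrees, as exactness of the bar complex. -/
theorem subsingleton_groupHomology_trivial_iff (G : Type) [Group G] (n : ℕ) :
    Subsingleton (groupHomology (Rep.trivial ℤ G ℤ) (n + 1)) ↔
      ∀ y, groupHomology.inhomogeneousChains.trivialD G n y = 0 →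
        ∃ x, groupHomology.inhomogeneousChains.trivialD G (n + 1) x = y := by
  rw [← ModuleCat.isZero_iff_subsingleton, groupHomology,
    ← HomologicalComplex.exactAt_iff_isZero_homology,
    HomologicalComplex.exactAt_iff' _ (n + 2) (n + 1) n (by simp) (by simp),
    ShortComplex.moduleCat_exact_iff]
  change (∀ y, (groupHomology.inhomogeneousChains _).d (n + 1) n y = 0 →
    ∃ x, (groupHomology.inhomogeneousChains _).d (n + 2) (n + 1) x = y) ↔ _
  rw [groupHomology.inhomogeneousChains.d_def, groupHomology.inhomogeneousChains.d_def]
  rfl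

/-- Vanishing of integral cohomology in positive degrees, as exactness of the dual of the bar
complex. -/
theorem subsingleton_groupCohomology_trivial_iff (G : Type) [Group G] (n : ℕ) :
    Subsingleton (groupCohomology (Rep.trivial ℤ G ℤ) (n + 1)) ↔
      ∀ φ : ((Fin (n + 1) → G) →₀ ℤ) →ₗ[ℤ] ℤ,
        φ ∘ₗ groupHomology.inhomogeneousChains.trivialD G (n + 1) = 0 →
        ∃ ψ : ((Fin n → G) →₀ ℤ) →ₗ[ℤ] ℤ,
          ψ ∘ₗ groupHomology.inhomogeneousChains.trivialD G n = φ := by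
  rw [← ModuleCat.isZero_iff_subsingleton, groupCohomology,
    ← HomologicalComplex.exactAt_iff_isZero_homology,
    HomologicalComplex.exactAt_iff' _ n (n + 1) (n + 2) (by simp) (by simp),
    ShortComplex.moduleCat_exact_iff]
  change (∀ y, (groupCohomology.inhomogeneousCochains _).d (n + 1) (n + 2) y = 0 →
    ∃ x, (groupCohomology.inhomogeneousCochains _).d n (n + 1) x = y) ↔ _
  rw [groupCohomology.inhomogeneousCochains.d_def, groupCohomology.inhomogeneousCochains.d_def]
  refine (Finsupp.llift ℤ ℤ ℤ (Fin (n + 1) → G)).toEquiv.forall_congr fun {f} =>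
    imp_congr ?_ ((Finsupp.llift ℤ ℤ ℤ (Fin n → G)).toEquiv.exists_congr fun {h} => ?_)
  · simp only [LinearEquiv.coe_toEquiv,
      groupHomology.inhomogeneousChains.llift_comp_trivialD]
    exact (LinearEquiv.map_eq_zero_iff _).symm
  · simp only [LinearEquiv.coe_toEquiv,
      groupHomology.inhomogeneousChains.llift_comp_trivialD]
    exact (LinearEquiv.injective _).eq_iff.symm

/-- Lemma 4.5: for a finite group `A`, the third group cohomology `H³(A; ℤ)` with trivial
integral coefficients vanishes if and only if the second group homology `H₂(A; ℤ)` (the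
Schur multiplier of `A`) with trivial integral coefficients vanishes. -/
theorem almost_flat_stmt4 (A : Type) [Group A] [Finite A] :
    Subsingleton (groupCohomology (Rep.trivial ℤ A ℤ) 3) ↔
      Subsingleton (groupHomology' (Rep.trivial ℤ A ℤ) 2) := by
  classical
  have := Fintype.ofFinite A
  have hcard (n : ℕ) : (-1) ^ n * (Fintype.card A : ℤ) ≠ 0 := by simp
  rw [((groupHomologyStandardIso (Rep.trivial ℤ A ℤ) 2).toLinearEquiv.toEquiv).subsingleton_congr,
    subsingleton_groupHomology_trivial_iff, subsingleton_groupCohomology_trivial_iff]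
  exact (exact_iff_dual_exact_of_homotopy
    (groupHomology.inhomogeneousChains.trivialD_comp_trivialD 2)
    (groupHomology.inhomogeneousChains.trivialD_comp_trivialD 1) (hcard 1) (hcard 2)
    (groupHomology.inhomogeneousChains.trivialD_comp_snocSum 1)
    (groupHomology.inhomogeneousChains.trivialD_comp_snocSum 2)).symm
end

section
/- Let h ∈ ℚ[[X]] be the formal power series with coefficient 1 in degree 0 and, for m ≥ 1, coefficient 1 in degree m if m is a power of 2 and coefficient 0 otherwise (so h = 1 + X + X² + X⁴ + X⁸ + ⋯). Suppose f ∈ ℚ[[X]] has constant coefficient 1 and satisfies f(X)² = h(X) · h(−X). Then every coefficient of f lies in ℤ[1/2]; that is, for every n ≥ 0 there exists m ∈ ℕ such that 2^m · (coefficient of Xⁿ in f) is an integer. -/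
open PowerSeries

/-- The subring `ℤ[1/2]` of `ℚ`. -/
def integersInvTwo : Subring ℚ where
  carrier := {q | ∃ m : ℕ, ∃ z : ℤ, (2 : ℚ) ^ m * q = z}
  mul_mem' := by
    rintro a b ⟨m, z, hz⟩ ⟨n, w, hw⟩
    exact ⟨m + n, z * w, by push_cast; rw [← hz, ← hw]; ring⟩
  one_mem' := ⟨0, 1, by simp⟩
  add_mem' := by
    rintro a b ⟨m, z, hz⟩ ⟨n, w, hw⟩
    exact ⟨m + n, 2 ^ n * z + 2 ^ m * w, by push_cast; rw [← hz, ← hw]; ring⟩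
  zero_mem' := ⟨0, 0, by simp⟩
  neg_mem' := by
    rintro a ⟨m, z, hz⟩
    exact ⟨m, -z, by push_cast; rw [← hz]; ring⟩

theorem mem_integersInvTwo_of_two_mul_mem {x : ℚ} (hx : 2 * x ∈ integersInvTwo) :
    x ∈ integersInvTwo := by
  obtain ⟨m, z, hz⟩ := hx
  exact ⟨m + 1, z, by rw [← hz]; ring⟩

theorem PowerSeries.coeff_mul_mem {R : Type*} [CommRing R] (S : Subring R) {f g : R⟦X⟧}
    (hf : ∀ n, coeff n f ∈ S) (hg : ∀ n, coeff n g ∈ S) (n : ℕ) : coeff n (f * g) ∈ S := by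
  rw [coeff_mul]
  exact sum_mem fun p _ => mul_mem (hf p.1) (hg p.2)

/-- If `S` is closed under halving, a square root with constant coefficient `1` of a power series
over `S` has coefficients in `S`. -/
theorem PowerSeries.coeff_mem_of_sq_coeff_mem {R : Type*} [CommRing R] (S : Subring R)
    (half : ∀ x : R, 2 * x ∈ S → x ∈ S) {f : R⟦X⟧} (hf0 : constantCoeff f = 1)
    (hf : ∀ n, coeff n (f ^ 2) ∈ S) (n : ℕ) : coeff n f ∈ S := by
  induction n using Nat.strong_induction_on with
  | _ n ih =>
    rcases Nat.eq_zero_or_pos n with rfl | hn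
    · rw [coeff_zero_eq_constantCoeff_apply, hf0]
      exact one_mem S
    · apply half
      set T := ((Finset.HasAntidiagonal.antidiagonal n).erase (0, n)).erase (n, 0) with hT
      have hsum : coeff n (f ^ 2) =
          2 * coeff n f + ∑ p ∈ T, coeff p.1 f * coeff p.2 f := by
        have hmem : (n, 0) ∈ (Finset.HasAntidiagonal.antidiagonal n).erase (0, n) := by
          simp [hn.ne']
        have hmem' : (0, n) ∈ Finset.HasAntidiagonal.antidiagonal n := by simp
        rw [sq, coeff_mul, ← Finset.add_sum_erase _ _ hmem', ← Finset.add_sum_erase _ _ hmem]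
        simp only [coeff_zero_eq_constantCoeff_apply, hf0]
        ring
      have hmemT : ∑ p ∈ T, coeff p.1 f * coeff p.2 f ∈ S := by
        refine sum_mem fun p hp => ?_
        obtain ⟨a, b⟩ := p
        simp only [hT, Finset.mem_erase, Finset.HasAntidiagonal.mem_antidiagonal, ne_eq,
          Prod.mk.injEq] at hp
        exact mul_mem (ih a (by omega)) (ih b (by omega))
      rw [eq_sub_of_add_eq hsum.symm]
      exact sub_mem (hf n) hmemT

/-- The characteristic series `G(x) = √(h(x)·h(-x))` lies in `ℤ[1/2][[x]]`: if
`h = 1 + X + X² + X⁴ + X⁸ + ⋯ ∈ ℚ[[X]]` and `f ∈ ℚ[[X]]` has constant coefficient `1`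
and satisfies `f² = h(X) · h(-X)`, then every coefficient of `f` becomes an integer after
multiplying by a suitable power of `2`. -/
theorem almost_flat_stmt12 (h f : PowerSeries ℚ)
    (hh0 : PowerSeries.coeff 0 h = 1)
    (hhpow : ∀ k : ℕ, PowerSeries.coeff (2 ^ k) h = 1)
    (hhzero : ∀ m : ℕ, m ≠ 0 → (∀ k : ℕ, m ≠ 2 ^ k) → PowerSeries.coeff m h = 0)
    (hf0 : PowerSeries.constantCoeff f = 1)
    (hfsq : f ^ 2 = h * PowerSeries.rescale (-1) h) :
    ∀ n : ℕ, ∃ m : ℕ, ∃ z : ℤ,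
      (2 : ℚ) ^ m * PowerSeries.coeff n f = (z : ℚ) := by
  have hh : ∀ n, coeff n h ∈ integersInvTwo := by
    intro n
    by_cases h0 : n = 0
    · rw [h0, hh0]
      exact one_mem _
    by_cases hp : ∃ k : ℕ, n = 2 ^ k
    · obtain ⟨k, rfl⟩ := hp
      rw [hhpow]
      exact one_mem _
    · rw [hhzero n h0 (not_exists.mp hp)]
      exact zero_mem _
  have hh' : ∀ n, coeff n (rescale (-1) h) ∈ integersInvTwo := by
    intro n
    rw [coeff_rescale]
    exact mul_mem (pow_mem (neg_mem (one_mem _)) n) (hh n)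
  exact coeff_mem_of_sq_coeff_mem integersInvTwo
    (fun _ => mem_integersInvTwo_of_two_mul_mem) hf0
    (hfsq ▸ coeff_mul_mem integersInvTwo hh hh')
end
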